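/- arXiv:2011.04593 — 4 statements merged into one kernel-verified Lean document; each statement's English description precedes it below -/
import Mathlib

section
/- Let (N,R) be an STP instance, let r∈R be any terminal, and set R'=R∖{r}. Let c be the cost of any minimum spanning tree of the distance network D_N(R'). Then (1/2)·(c + min(d_N(r,u)+d_N(r,v))) ≤ csmt(N,R), where the minimum is taken over pairs u,v∈R' with u≠v, except that if |R'|=1 the minimum is taken over the single pair u=v equal to the unique element of R'. -/
open SimpleGraph

variable {V : Type*}

/-- The cost of a walk: the sum of the costs of its edges. -/
def walkCost {G : SimpleGraph V} (σ : Sym2 V → ℕ) {u v : V} (w : G.Walk u v) : ℕ :=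
  (w.edges.map σ).sum

/-- The shortest-path distance `d_N(u,v)` in the network `(G, σ)`. -/
noncomputable def netDist (G : SimpleGraph V) (σ : Sym2 V → ℕ) (u v : V) : ℕ :=
  sInf {c | ∃ w : G.Walk u v, walkCost σ w = c}

/-- Shortest-path distance as a function on unordered pairs. -/
noncomputable def sym2Dist (G : SimpleGraph V) (σ : Sym2 V → ℕ) (e : Sym2 V) : ℕ :=
  sInf {c | ∃ x y : V, e = s(x, y) ∧ ∃ w : G.Walk x y, walkCost σ w = c}

/-- The cost of a subgraph: the sum of the costs of its edges. -/
noncomputable def subCost [Fintype V] {G : SimpleGraph V} (σ : Sym2 V → ℕ)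
    (H : G.Subgraph) : ℕ :=
  ∑ e ∈ H.edgeSet.toFinite.toFinset, σ e

/-- A Steiner tree for terminals `R`: a subtree of `G` whose vertex set contains `R`. -/
def IsSteinerTree {G : SimpleGraph V} (R : Set V) (H : G.Subgraph) : Prop :=
  H.coe.IsTree ∧ R ⊆ H.verts

/-- The minimum cost of a Steiner tree for `(G, σ, R)`. -/
noncomputable def csmt [Fintype V] (G : SimpleGraph V) (σ : Sym2 V → ℕ) (R : Set V) : ℕ :=
  sInf {c | ∃ H : G.Subgraph, IsSteinerTree R H ∧ subCost σ H = c}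

/-- A Steiner minimal tree (SMT). -/
def IsSMT [Fintype V] (G : SimpleGraph V) (σ : Sym2 V → ℕ) (R : Set V)
    (H : G.Subgraph) : Prop :=
  IsSteinerTree R H ∧ subCost σ H = csmt G σ R

/-- The sub-SMT cost `l*(u, I) = csmt(N, I ∪ {u})`. -/
noncomputable def lstar [Fintype V] (G : SimpleGraph V) (σ : Sym2 V → ℕ)
    (u : V) (I : Set V) : ℕ :=
  csmt G σ (I ∪ {u})

/-- The cost of a minimum spanning tree of the complete network on `S`
with edge weights `w` (as a function on unordered pairs of `V`). -/
noncomputable def mstCost [Fintype V] (w : Sym2 V → ℕ) (S : Set V) : ℕ :=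
  sInf {c | ∃ T : SimpleGraph ↥S, T.IsTree ∧
    c = ∑ e ∈ T.edgeSet.toFinite.toFinset, w (e.map (Subtype.val : ↥S → V))}

-- Auxiliary fold computing the Steiner distance of a walk: the pair of
-- (the maximum cost among the already completed elementary segments,
-- the cost of the initial elementary segment), where the walk is split at
-- every visited terminal of `R`.
open Classical in
noncomputable def segMax {G : SimpleGraph V} (σ : Sym2 V → ℕ) (R : Set V) :
    {a b : V} → G.Walk a b → ℕ × ℕ
  | _, _, SimpleGraph.Walk.nil => (0, 0)
  | _, _, @SimpleGraph.Walk.cons _ _ a c _ _ w =>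
      let p := segMax σ R w
      if c ∈ R then (max p.1 p.2, σ s(a, c)) else (p.1, σ s(a, c) + p.2)

/-- The Steiner distance of a walk with respect to terminals `R`:
the maximum cost among its elementary subpaths (obtained by splitting the
walk at the intermediate terminals). -/
noncomputable def walkSD {G : SimpleGraph V} (σ : Sym2 V → ℕ) (R : Set V)
    {a b : V} (w : G.Walk a b) : ℕ :=
  max (segMax σ R w).1 (segMax σ R w).2

/-- The restricted bottleneck Steiner distance `s̄(u,v)`: the minimum Steiner
distance among all paths connecting `u` and `v` that avoid the edge `{u,v}`. -/
noncomputable def restrictedBottleneck (G : SimpleGraph V) (σ : Sym2 V → ℕ)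
    (R : Set V) (u v : V) : ℕ :=
  sInf {c | ∃ w : G.Walk u v, w.IsPath ∧ s(u, v) ∉ w.edges ∧ walkSD σ R w = c}

/-- The bottleneck Steiner distance as a function on unordered pairs. -/
noncomputable def sym2Bottleneck (G : SimpleGraph V) (σ : Sym2 V → ℕ) (R : Set V)
    (e : Sym2 V) : ℕ :=
  sInf {c | ∃ x y : V, e = s(x, y) ∧ ∃ w : G.Walk x y, w.IsPath ∧ walkSD σ R w = c}

theorem netDist_le_walkCost {G : SimpleGraph V} (σ : Sym2 V → ℕ) {u v : V} (w : G.Walk u v) :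
    netDist G σ u v ≤ walkCost σ w :=
  Nat.sInf_le ⟨w, rfl⟩

theorem exists_walkCost_eq_netDist {G : SimpleGraph V} (hconn : G.Connected) (σ : Sym2 V → ℕ)
    (u v : V) : ∃ w : G.Walk u v, walkCost σ w = netDist G σ u v :=
  Nat.sInf_mem (s := {c | ∃ w : G.Walk u v, walkCost σ w = c})
    ((hconn.preconnected u v).elim fun w => ⟨_, w, rfl⟩)

theorem walkCost_append {G : SimpleGraph V} (σ : Sym2 V → ℕ) {u v x : V}
    (p : G.Walk u v) (q : G.Walk v x) :
    walkCost σ (p.append q) = walkCost σ p + walkCost σ q := by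
  simp [walkCost]

theorem netDist_triangle {G : SimpleGraph V} (hconn : G.Connected) (σ : Sym2 V → ℕ)
    (u v x : V) : netDist G σ u x ≤ netDist G σ u v + netDist G σ v x := by
  obtain ⟨p, hp⟩ := exists_walkCost_eq_netDist hconn σ u v
  obtain ⟨q, hq⟩ := exists_walkCost_eq_netDist hconn σ v x
  rw [← hp, ← hq, ← walkCost_append]
  exact netDist_le_walkCost σ _

theorem netDist_comm {G : SimpleGraph V} (hconn : G.Connected) (σ : Sym2 V → ℕ)
    (u v : V) : netDist G σ u v = netDist G σ v u := by
  have key : ∀ a b, netDist G σ a b ≤ netDist G σ b a := fun a b => by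
    obtain ⟨p, hp⟩ := exists_walkCost_eq_netDist hconn σ b a
    rw [← hp]
    refine (netDist_le_walkCost σ p.reverse).trans_eq ?_
    simp [walkCost]
  exact (key u v).antisymm (key v u)

theorem sym2Dist_le_netDist {G : SimpleGraph V} (hconn : G.Connected) (σ : Sym2 V → ℕ)
    (u v : V) : sym2Dist G σ s(u, v) ≤ netDist G σ u v :=
  Nat.sInf_le ⟨u, v, rfl, exists_walkCost_eq_netDist hconn σ u v⟩

/-- The total length of the tour that starts at `a`, visits the members of a list in order, and
ends at `b`. -/
noncomputable def tourCost (d : V → V → ℕ) (b : V) : V → List V → ℕ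
  | a, [] => d a b
  | a, x :: l => d a x + tourCost d b x l

/-- The total length of the path that starts at `a` and visits the members of a list in order. -/
noncomputable def pathCost (d : V → V → ℕ) : V → List V → ℕ
  | _, [] => 0
  | a, x :: l => d a x + pathCost d x l

theorem tourCost_eq_pathCost_add (d : V → V → ℕ) (b a : V) (l : List V) :
    tourCost d b a l = pathCost d a l + d ((a :: l).getLast (List.cons_ne_nil _ _)) b := by
  induction l generalizing a with
  | nil => simp [tourCost, pathCost]
  | cons x l ih => simp [tourCost, pathCost, ih, add_assoc]

theorem tourCost_le_add {d : V → V → ℕ} (hd : ∀ u v x, d u x ≤ d u v + d v x)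
    (b a x : V) (l : List V) : tourCost d b a l ≤ d a x + tourCost d b x l := by
  cases l with
  | nil => exact hd a x b
  | cons y l =>
    simp only [tourCost]
    have := hd a x y
    omega

theorem List.Sublist.tourCost_le {d : V → V → ℕ} (hd : ∀ u v x, d u x ≤ d u v + d v x)
    {l₁ l₂ : List V} (h : l₁.Sublist l₂) (b a : V) : tourCost d b a l₁ ≤ tourCost d b a l₂ := by
  induction h generalizing a with
  | slnil => exact le_rfl
  | cons x _ ih => exact (tourCost_le_add hd b a x _).trans (Nat.add_le_add_left (ih x) _)
  | cons_cons x _ ih => exact Nat.add_le_add_left (ih x) _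

theorem tourCost_support_tail_le_walkCost {G : SimpleGraph V} (σ : Sym2 V → ℕ) {a b : V}
    (p : G.Walk a b) : tourCost (netDist G σ) b a p.support.tail ≤ walkCost σ p := by
  induction p with
  | nil => exact netDist_le_walkCost σ _
  | @cons u v x h p ih =>
    have h₁ : netDist G σ u v ≤ σ s(u, v) := by
      simpa [walkCost] using netDist_le_walkCost σ (Walk.cons h Walk.nil)
    have h₂ : walkCost σ (Walk.cons h p) = σ s(u, v) + walkCost σ p := by simp [walkCost]
    rw [h₂, Walk.support_cons, List.tail_cons, ← Walk.cons_tail_support]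
    exact Nat.add_le_add h₁ ih

/-- The graph whose edges join consecutive members of a list. -/
def listGraph {α : Type*} (a : α) (l : List α) : SimpleGraph α :=
  fromEdgeSet {e | e ∈ ((a :: l).zip l).map fun p => s(p.1, p.2)}

theorem listGraph_reachable {α : Type*} {a : α} {l : List α} (h : (a :: l).Nodup) {x : α}
    (hx : x ∈ a :: l) : (listGraph a l).Reachable a x := by
  induction l generalizing a with
  | nil =>
    obtain rfl : x = a := by simpa using hx
    exact .refl _
  | cons y l ih =>
    rcases List.mem_cons.1 hx with rfl | hx
    · exact .refl _
    · have hadj : (listGraph a (y :: l)).Adj a y := by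
        refine (fromEdgeSet_adj _).2 ⟨by simp, ?_⟩
        rintro rfl
        simp at h
      have hle : listGraph y l ≤ listGraph a (y :: l) :=
        fromEdgeSet_mono fun e he => by
          rw [Set.mem_ofPred_eq, List.zip_cons_cons, List.map_cons]
          exact List.mem_cons_of_mem _ he
      exact hadj.reachable.trans ((ih h.of_cons hx).mono hle)

theorem sum_zip_le_pathCost {S : Set V} {d : V → V → ℕ} {w : Sym2 V → ℕ}
    (hw : ∀ u v, w s(u, v) ≤ d u v) (a : S) (l : List S) :
    ((((a :: l).zip l).map fun p => s(p.1, p.2)).map fun e => w (e.map Subtype.val)).sum ≤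
      pathCost d a (l.map Subtype.val) := by
  induction l generalizing a with
  | nil => simp
  | cons y l ih =>
    simp only [List.zip_cons_cons, List.map_cons, List.sum_cons, pathCost, Sym2.map_mk]
    exact Nat.add_le_add (hw _ _) (ih y)

theorem sum_toFinset_le_sum_map {α : Type*} [DecidableEq α] (l : List α) (f : α → ℕ) :
    ∑ x ∈ l.toFinset, f x ≤ (l.map f).sum := by
  rw [Finset.sum_list_map_count]
  refine Finset.sum_le_sum fun x hx => ?_
  have := List.count_pos_iff.2 (List.mem_toFinset.1 hx)
  simpa using Nat.le_mul_of_pos_left (f x) this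

theorem mstCost_le_pathCost [Fintype V] {S : Set V} {d : V → V → ℕ} {w : Sym2 V → ℕ}
    (hw : ∀ u v, w s(u, v) ≤ d u v) {a : V} {l : List V} (hnd : (a :: l).Nodup)
    (hS : ∀ x, x ∈ a :: l ↔ x ∈ S) : mstCost w S ≤ pathCost d a l := by
  classical
  lift a to S using (hS a).1 (by simp)
  lift l to List S using fun x hx => (hS x).1 (List.mem_cons_of_mem _ hx)
  rw [← List.map_cons] at hnd
  have hnd' := List.Nodup.of_map _ hnd
  have hmem : ∀ x : S, x ∈ a :: l := fun x => by
    have := (hS x).2 x.2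
    rw [← List.map_cons] at this
    exact (List.mem_map_of_injective Subtype.val_injective).1 this
  have hcon : (listGraph a l).Connected :=
    connected_iff_exists_forall_reachable _ |>.2
      ⟨a, fun x => listGraph_reachable hnd' (hmem x)⟩
  obtain ⟨T, hTle, hT⟩ := hcon.exists_isTree_le
  have hmst : mstCost w S ≤ ∑ e ∈ T.edgeSet.toFinite.toFinset, w (e.map Subtype.val) :=
    Nat.sInf_le ⟨T, hT, rfl⟩
  refine hmst.trans (le_trans ?_ (sum_zip_le_pathCost hw a l))
  refine le_trans (Finset.sum_le_sum_of_subset ?_) (sum_toFinset_le_sum_map _ _)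
  intro e he
  have he' := edgeSet_mono hTle ((Set.Finite.mem_toFinset _).1 he)
  rw [listGraph, edgeSet_fromEdgeSet] at he'
  exact List.mem_toFinset.2 he'.1

theorem exists_walk_insert {G : SimpleGraph V} [DecidableEq V] (σ : Sym2 V → ℕ) {r x y : V}
    (p : G.Walk r r) (hx : x ∈ p.support) (hy : y ∉ p.support) (h : G.Adj x y)
    (hp : walkCost σ p ≤ 2 * ∑ e ∈ p.edges.toFinset, σ e) :
    ∃ q : G.Walk r r, (∀ v, v ∈ q.support ↔ v = y ∨ v ∈ p.support) ∧
      q.edges.toFinset = insert s(x, y) p.edges.toFinset ∧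
      walkCost σ q ≤ 2 * ∑ e ∈ q.edges.toFinset, σ e := by
  have hspec := p.take_spec hx
  have hq : ((p.takeUntil x hx).append
      ((Walk.cons h (Walk.cons h.symm Walk.nil)).append (p.dropUntil x hx))).edges.toFinset =
      insert s(x, y) p.edges.toFinset := by
    conv_rhs => rw [← hspec]
    ext e
    simp only [Walk.edges_append, Walk.edges_cons, Walk.edges_nil, List.mem_toFinset,
      List.mem_append, List.mem_cons, List.not_mem_nil, Finset.mem_insert, Sym2.eq_swap (a := y)]
    tauto
  refine ⟨_, fun v => ?_, hq, ?_⟩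
  · conv_rhs => rw [← hspec]
    simp only [Walk.mem_support_append_iff, Walk.support_cons, Walk.support_nil, List.mem_cons,
      List.not_mem_nil]
    have : x ∈ (p.takeUntil x hx).support := Walk.end_mem_support _
    constructor
    · rintro (h | (rfl | rfl | rfl | h) | h) <;> simp_all
    · tauto
  · have hnot : s(x, y) ∉ p.edges.toFinset := fun he =>
      hy (p.snd_mem_support_of_mem_edges (List.mem_toFinset.1 he))
    rw [hq, Finset.sum_insert hnot]
    have hc : walkCost σ p = walkCost σ (p.takeUntil x hx) + walkCost σ (p.dropUntil x hx) := by
      rw [← walkCost_append, hspec]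
    rw [walkCost_append, walkCost_append]
    have : walkCost σ (Walk.cons h (Walk.cons h.symm Walk.nil)) = 2 * σ s(x, y) := by
      simp [walkCost, Sym2.eq_swap (a := y), two_mul]
    omega

/-- A connected subgraph has a closed walk visiting all its vertices whose cost is at most twice
the cost of the subgraph. -/
theorem exists_closed_walk_walkCost_le [Fintype V] {G : SimpleGraph V} (σ : Sym2 V → ℕ)
    {H : G.Subgraph} (hH : H.coe.Connected) {r : V} (hr : r ∈ H.verts) :
    ∃ p : G.Walk r r, (∀ v ∈ H.verts, v ∈ p.support) ∧ walkCost σ p ≤ 2 * subCost σ H := by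
  classical
  let P : ℕ → Prop := fun n => ∃ p : G.Walk r r, p.support.toFinset.card = n ∧
    (∀ e ∈ p.edges, e ∈ H.edgeSet) ∧ walkCost σ p ≤ 2 * ∑ e ∈ p.edges.toFinset, σ e
  have hP : P 1 := ⟨Walk.nil, by simp, by simp, by simp [walkCost]⟩
  have hbound : ∀ n, P n → n ≤ Fintype.card V := by
    rintro n ⟨p, rfl, -⟩
    exact Finset.card_le_univ _
  obtain ⟨p, hcard, hedge, hcost⟩ : P (Nat.findGreatest P (Fintype.card V)) :=
    Nat.findGreatest_spec (hbound 1 hP) hP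
  refine ⟨p, ?_, hcost.trans (Nat.mul_le_mul_left 2 (Finset.sum_le_sum_of_subset fun e he => ?_))⟩
  · by_contra! hv
    obtain ⟨v, hvH, hv⟩ := hv
    obtain ⟨w⟩ := hH.preconnected ⟨r, hr⟩ ⟨v, hvH⟩
    obtain ⟨d, -, hx, hy⟩ := w.exists_boundary_dart {z | z.1 ∈ p.support} (by simp) hv
    have hadj : H.Adj d.fst d.snd := d.adj
    obtain ⟨q, hqs, hqe, hqc⟩ := exists_walk_insert σ p hx hy hadj.adj_sub hcost
    have hQ : P q.support.toFinset.card := by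
      refine ⟨q, rfl, fun e he => ?_, hqc⟩
      rw [← List.mem_toFinset, hqe, Finset.mem_insert, List.mem_toFinset] at he
      rcases he with rfl | he
      · exact hadj
      · exact hedge e he
    have hle := Nat.le_findGreatest (hbound _ hQ) hQ
    have hins : q.support.toFinset = insert d.snd.1 p.support.toFinset := by
      ext z
      simp [hqs]
    rw [← hcard, hins, Finset.card_insert_of_notMem (by simpa using hy)] at hle
    omega
  · exact (Set.Finite.mem_toFinset _).2 (hedge e (List.mem_toFinset.1 he))

theorem exists_isSMT [Fintype V] {G : SimpleGraph V} (hconn : G.Connected) (σ : Sym2 V → ℕ)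
    (R : Set V) : ∃ H : G.Subgraph, IsSMT G σ R H := by
  obtain ⟨T, hle, hT⟩ := hconn.exists_isTree_le
  have hsp := toSubgraph.isSpanning T hle
  have hST : IsSteinerTree R (toSubgraph T hle) :=
    ⟨((toSubgraph T hle).spanningCoeEquivCoeOfSpanning hsp).isTree_iff.1 hT, fun v _ => hsp v⟩
  exact Nat.sInf_mem (s := {c | ∃ H : G.Subgraph, IsSteinerTree R H ∧ subCost σ H = c})
    ⟨_, _, hST, rfl⟩

/-- The 1-tree lower bound on the cost of a Steiner minimal tree.
Stated in the equivalent form `c + m ≤ 2 · csmt(N,R)`. -/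
theorem one_tree_lower_bound
    [Fintype V] (G : SimpleGraph V) (σ : Sym2 V → ℕ)
    (hconn : G.Connected) (hpos : ∀ e ∈ G.edgeSet, 0 < σ e)
    (R : Set V) (r : V) (hr : r ∈ R) (hR' : (R \ {r}).Nonempty)
    (c : ℕ) (hc : c = mstCost (sym2Dist G σ) (R \ {r})) :
    c + sInf {m | ∃ u ∈ R \ {r}, ∃ v ∈ R \ {r},
        (u ≠ v ∨ R \ {r} = {u}) ∧ m = netDist G σ r u + netDist G σ r v}
      ≤ 2 * csmt G σ R := by
  classical
  obtain ⟨H, ⟨hT, hRH⟩, hcost⟩ := exists_isSMT hconn σ R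
  obtain ⟨p, hcover, hp⟩ := exists_closed_walk_walkCost_le σ hT.connected (hRH hr)
  rw [hcost] at hp
  have hmem : ∀ x, x ∈ (p.support.tail.filter (· ∈ R \ {r})).dedup ↔ x ∈ R \ {r} := by
    intro x
    simp only [List.mem_dedup, List.mem_filter, decide_eq_true_eq, and_iff_right_iff_imp]
    intro hx
    have := hcover x (hRH hx.1)
    rw [← Walk.cons_tail_support] at this
    exact (List.mem_cons.1 this).resolve_left hx.2
  have hsub : (p.support.tail.filter (· ∈ R \ {r})).dedup.Sublist p.support.tail :=
    (List.dedup_sublist _).trans List.filter_sublist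
  have hnd := List.nodup_dedup (p.support.tail.filter (· ∈ R \ {r}))
  generalize (p.support.tail.filter (· ∈ R \ {r})).dedup = l at hmem hsub hnd
  have htour := (hsub.tourCost_le (netDist_triangle hconn σ) r r).trans
    ((tourCost_support_tail_le_walkCost σ p).trans hp)
  cases l with
  | nil =>
    obtain ⟨x, hx⟩ := hR'
    simpa using (hmem x).2 hx
  | cons u l =>
    have hmst := mstCost_le_pathCost (sym2Dist_le_netDist hconn σ) hnd hmem
    rw [← hc] at hmst
    rw [tourCost, tourCost_eq_pathCost_add] at htour
    have hlast := List.getLast_mem (List.cons_ne_nil u l)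
    have hinf := Nat.sInf_le (s := {m | ∃ u ∈ R \ {r}, ∃ v ∈ R \ {r},
        (u ≠ v ∨ R \ {r} = {u}) ∧ m = netDist G σ r u + netDist G σ r v})
      ⟨u, (hmem u).1 List.mem_cons_self, _, (hmem _).1 hlast, ?_, rfl⟩
    · rw [netDist_comm hconn σ _ r] at htour
      omega
    · cases l with
      | nil =>
        right
        ext x
        rw [← hmem]
        simp
      | cons y l =>
        left
        rw [List.getLast_cons (List.cons_ne_nil _ _)]
        rintro h
        exact (List.nodup_cons.1 hnd).1 (h ▸ List.getLast_mem _)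
end

section
/- Let (N,R) be an STP instance with N=(V,E,σ). For every vertex u∈V and every set I⊆R with |I|≥2, at least one of the following two cases holds: (1) there exists J with ∅⊊J⊊I such that l*(u,I) = l*(u,J) + l*(u,I∖J); or (2) there exists a vertex v∈V with v≠u such that l*(u,I) = l*(v,I) + d_N(u,v) and such that case (1) holds for the pair (v,I). -/
open SimpleGraph

variable {V : Type*}

namespace SteinerTree

lemma subCost_mono_add [Fintype V] {G : SimpleGraph V} (σ : Sym2 V → ℕ) {H K L : G.Subgraph}
    (h : L.edgeSet ⊆ H.edgeSet ∪ K.edgeSet) : subCost σ L ≤ subCost σ H + subCost σ K := by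
  classical
  unfold subCost
  rw [← Finset.sum_union_inter]
  refine le_trans (Finset.sum_le_sum_of_subset ?_) (Nat.le_add_right _ _)
  intro e he
  simpa using h (by simpa using he)

lemma subCost_sup_le [Fintype V] {G : SimpleGraph V} (σ : Sym2 V → ℕ) (H K : G.Subgraph) :
    subCost σ (H ⊔ K) ≤ subCost σ H + subCost σ K :=
  subCost_mono_add σ (by rw [Subgraph.edgeSet_sup])

lemma subCost_subgraphOfAdj [Fintype V] {G : SimpleGraph V} (σ : Sym2 V → ℕ) {u x : V}
    (h : G.Adj u x) : subCost σ (G.subgraphOfAdj h) = σ s(u, x) := by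
  simp [subCost]

lemma subCost_toSubgraph_le [Fintype V] {G : SimpleGraph V} (σ : Sym2 V → ℕ) {u v : V}
    (w : G.Walk u v) : subCost σ w.toSubgraph ≤ walkCost σ w := by
  induction w with
  | nil => simp [subCost, walkCost, Walk.toSubgraph]
  | cons h p ih =>
    have := subCost_sup_le σ (G.subgraphOfAdj h) p.toSubgraph
    rw [subCost_subgraphOfAdj] at this
    simp only [walkCost, Walk.edges_cons, List.map_cons, List.sum_cons, Walk.toSubgraph] at ih ⊢
    omega

lemma subCost_add_le [Fintype V] {G : SimpleGraph V} (σ : Sym2 V → ℕ) {H K T : G.Subgraph}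
    (hH : H ≤ T) (hK : K ≤ T) (hd : Disjoint H.edgeSet K.edgeSet) :
    subCost σ H + subCost σ K ≤ subCost σ T := by
  classical
  unfold subCost
  rw [← Finset.sum_union]
  · refine Finset.sum_le_sum_of_subset fun e he => ?_
    simp only [Finset.mem_union, Set.Finite.mem_toFinset] at he ⊢
    exact he.elim (fun h => Subgraph.edgeSet_mono hH h) (fun h => Subgraph.edgeSet_mono hK h)
  · rw [Finset.disjoint_left]
    intro e he he'
    exact Set.disjoint_left.1 hd (by simpa using he) (by simpa using he')

/-- A connected subgraph has a spanning subtree. -/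
lemma exists_isTree_le {G : SimpleGraph V} [Finite V] {H : G.Subgraph} (hH : H.Connected) :
    ∃ T : G.Subgraph, T ≤ H ∧ T.verts = H.verts ∧ T.coe.IsTree := by
  obtain ⟨T, hT, hTree⟩ := hH.coe.exists_isTree_le
  let T' : G.Subgraph :=
    { verts := H.verts
      Adj := fun a b => ∃ (ha : a ∈ H.verts) (hb : b ∈ H.verts), T.Adj ⟨a, ha⟩ ⟨b, hb⟩
      adj_sub := fun ⟨_, _, h⟩ => H.adj_sub (hT h)
      edge_vert := fun ⟨ha, _, _⟩ => ha
      symm := ⟨fun _ _ ⟨ha, hb, h⟩ => ⟨hb, ha, h.symm⟩⟩ }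
  have hcoe : T'.coe = T := by
    ext a b
    exact ⟨fun ⟨_, _, h⟩ => h, fun h => ⟨a.2, b.2, h⟩⟩
  refine ⟨T', ⟨le_rfl, fun a b ⟨_, _, h⟩ => hT h⟩, rfl, ?_⟩
  rw [hcoe]
  exact hTree

lemma csmt_le_subCost [Fintype V] {G : SimpleGraph V} (σ : Sym2 V → ℕ) {S : Set V}
    {H : G.Subgraph} (hH : H.Connected) (hS : S ⊆ H.verts) : csmt G σ S ≤ subCost σ H := by
  obtain ⟨T, hle, hverts, hT⟩ := exists_isTree_le hH
  have h₁ : csmt G σ S ≤ subCost σ T := Nat.sInf_le ⟨T, ⟨hT, hverts ▸ hS⟩, rfl⟩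
  have h₂ := subCost_mono_add σ (K := (⊥ : G.Subgraph)) (L := T) (H := H)
    (fun e he => Or.inl (Subgraph.edgeSet_mono hle he))
  have h₃ : subCost σ (⊥ : G.Subgraph) = 0 := by simp [subCost]
  omega

lemma exists_connected_subCost_eq_csmt [Fintype V] {G : SimpleGraph V} (σ : Sym2 V → ℕ)
    (hconn : G.Connected) (S : Set V) :
    ∃ H : G.Subgraph, H.Connected ∧ S ⊆ H.verts ∧ subCost σ H = csmt G σ S := by
  have htop : (⊤ : G.Subgraph).Connected := ⟨Subgraph.topIso.connected_iff.2 hconn⟩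
  obtain ⟨T, -, hverts, hT⟩ := exists_isTree_le htop
  have hne : {c | ∃ H : G.Subgraph, IsSteinerTree S H ∧ subCost σ H = c}.Nonempty :=
    ⟨_, T, ⟨hT, by simp [hverts]⟩, rfl⟩
  obtain ⟨H, hH, hc⟩ := Nat.sInf_mem hne
  exact ⟨H, ⟨hH.1.connected⟩, hH.2, hc⟩

lemma csmt_union_le [Fintype V] {G : SimpleGraph V} (σ : Sym2 V → ℕ) (hconn : G.Connected)
    {S S' : Set V} (h : (S ∩ S').Nonempty) : csmt G σ (S ∪ S') ≤ csmt G σ S + csmt G σ S' := by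
  obtain ⟨H, hH, hS, hc⟩ := exists_connected_subCost_eq_csmt σ hconn S
  obtain ⟨K, hK, hS', hc'⟩ := exists_connected_subCost_eq_csmt σ hconn S'
  obtain ⟨a, ha, ha'⟩ := h
  rw [← hc, ← hc']
  exact (csmt_le_subCost σ (Subgraph.connected_sup hH.preconnected hK.preconnected
    ⟨a, hS ha, hS' ha'⟩)
    (Set.union_subset_union hS hS')).trans (subCost_sup_le σ H K)

lemma lstar_le_add [Fintype V] {G : SimpleGraph V} (σ : Sym2 V → ℕ) (hconn : G.Connected)
    (u : V) {I J : Set V} (hJ : J ⊆ I) :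
    lstar G σ u I ≤ lstar G σ u J + lstar G σ u (I \ J) := by
  have h := csmt_union_le σ hconn (S := J ∪ {u}) (S' := (I \ J) ∪ {u}) ⟨u, by simp⟩
  rwa [← Set.union_union_distrib_right, Set.union_sdiff_cancel hJ] at h

lemma exists_walkCost_eq_netDist {G : SimpleGraph V} (σ : Sym2 V → ℕ) (hconn : G.Connected)
    (u v : V) : ∃ w : G.Walk u v, walkCost σ w = netDist G σ u v :=
  Nat.sInf_mem (s := {c | ∃ w : G.Walk u v, walkCost σ w = c})
    ((hconn u v).elim fun w => ⟨_, w, rfl⟩)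

lemma netDist_self (G : SimpleGraph V) (σ : Sym2 V → ℕ) (u : V) : netDist G σ u u = 0 :=
  Nat.le_zero.1 (Nat.sInf_le ⟨Walk.nil, by simp [walkCost]⟩)

lemma netDist_le_add {G : SimpleGraph V} (σ : Sym2 V → ℕ) (hconn : G.Connected) {u x : V}
    (h : G.Adj u x) (v : V) : netDist G σ u v ≤ σ s(u, x) + netDist G σ x v := by
  obtain ⟨w, hw⟩ := exists_walkCost_eq_netDist σ hconn x v
  rw [← hw]
  exact Nat.sInf_le ⟨Walk.cons h w, by simp [walkCost]⟩

lemma lstar_le_add_netDist [Fintype V] {G : SimpleGraph V} (σ : Sym2 V → ℕ)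
    (hconn : G.Connected) (u v : V) (I : Set V) :
    lstar G σ u I ≤ lstar G σ v I + netDist G σ u v := by
  obtain ⟨w, hw⟩ := exists_walkCost_eq_netDist σ hconn u v
  obtain ⟨H, hH, hS, hc⟩ := exists_connected_subCost_eq_csmt σ hconn (I ∪ {v})
  have hcon := Subgraph.connected_sup hH.preconnected
    w.toSubgraph_connected.preconnected ⟨v, hS (by simp), w.end_mem_verts_toSubgraph⟩
  have h₁ := csmt_le_subCost σ (S := I ∪ {u}) hcon (Set.union_subset_union
    (Set.subset_union_left.trans hS) (by simp))
  have h₂ := subCost_sup_le σ H w.toSubgraph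
  have h₃ := subCost_toSubgraph_le σ w
  unfold lstar
  omega

/-- The subgraph of `G` formed by the connected component of `u` in a spanning subgraph `D`. -/
def componentSubgraph {G D : SimpleGraph V} (hD : D ≤ G) (u : V) : G.Subgraph where
  verts := {a | D.Reachable u a}
  Adj a b := D.Adj a b ∧ D.Reachable u a
  adj_sub h := hD h.1
  edge_vert h := h.2
  symm := ⟨fun _ _ h => ⟨h.1.symm, h.2.trans h.1.reachable⟩⟩

lemma componentSubgraph_connected {G D : SimpleGraph V} (hD : D ≤ G) (u : V) :
    (componentSubgraph hD u).Connected := by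
  have key : ∀ {a b : V} (w : D.Walk a b) (ha : D.Reachable u a) (hb : D.Reachable u b),
      (componentSubgraph hD u).coe.Reachable ⟨a, ha⟩ ⟨b, hb⟩ := by
    intro a b w
    induction w with
    | nil => exact fun _ _ => Reachable.refl _
    | @cons a c b h p ih =>
      intro ha hb
      have hc : D.Reachable u c := ha.trans h.reachable
      have hac : (componentSubgraph hD u).coe.Adj ⟨a, ha⟩ ⟨c, hc⟩ := ⟨h, ha⟩
      exact hac.reachable.trans (ih hc hb)
  rw [Subgraph.connected_iff']
  have : Nonempty (componentSubgraph hD u).verts := ⟨⟨u, Reachable.refl u⟩⟩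
  refine ⟨fun a b => ?_⟩
  obtain ⟨w⟩ := Reachable.trans (Reachable.symm a.2) b.2
  exact key w a.2 b.2

/-- Splitting a minimum-cost connected subgraph at an edge. -/
lemma exists_split [Fintype V] {G : SimpleGraph V} {σ : Sym2 V → ℕ}
    (hpos : ∀ e ∈ G.edgeSet, 0 < σ e) {S : Set V} {T : G.Subgraph} (hT : T.Connected)
    (hS : S ⊆ T.verts) (hmin : subCost σ T = csmt G σ S) {u x : V} (hux : T.Adj u x) :
    ∃ A B : G.Subgraph, A.Connected ∧ B.Connected ∧ u ∈ A.verts ∧ x ∈ B.verts ∧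
      T.verts ⊆ A.verts ∪ B.verts ∧ subCost σ A + subCost σ B + σ s(u, x) ≤ subCost σ T := by
  let D : SimpleGraph V := T.spanningCoe.deleteEdges {s(u, x)}
  have hDadj : ∀ {a b}, D.Adj a b ↔ T.Adj a b ∧ s(a, b) ≠ s(u, x) := by
    intro a b
    simp only [D, deleteEdges_adj, Subgraph.spanningCoe_adj, Set.mem_singleton_iff, ne_eq]
  have hD : D ≤ G := fun a b h => T.adj_sub (hDadj.1 h).1
  have hle : ∀ y ∈ T.verts, componentSubgraph hD y ≤ T := by
    intro y hy
    refine ⟨fun a ha => ?_, fun a b h => (hDadj.1 h.1).1⟩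
    obtain ⟨w⟩ := Reachable.symm ha
    cases w with
    | nil => exact hy
    | cons h _ => exact T.edge_vert (hDadj.1 h).1
  have hcover : ∀ a ∈ T.verts, D.Reachable u a ∨ D.Reachable x a := by
    have key : ∀ {a b : T.verts} (w : T.coe.Walk a b),
        (D.Reachable u a ∨ D.Reachable x a) → (D.Reachable u b ∨ D.Reachable x b) := by
      intro a b w
      induction w with
      | nil => exact id
      | @cons a c b h p ih =>
        refine fun ha => ih ?_
        by_cases he : s((a : V), (c : V)) = s(u, x)
        · rcases Sym2.eq_iff.1 he with ⟨-, hc⟩ | ⟨-, hc⟩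
          · exact Or.inr (hc ▸ Reachable.refl _)
          · exact Or.inl (hc ▸ Reachable.refl _)
        · have hac : D.Adj a c := hDadj.2 ⟨h, he⟩
          exact ha.imp (·.trans hac.reachable) (·.trans hac.reachable)
    intro a ha
    obtain ⟨w⟩ := hT.coe ⟨u, T.edge_vert hux⟩ ⟨a, ha⟩
    exact key w (Or.inl (Reachable.refl _))
  have hσ := hpos s(u, x) (T.adj_sub hux)
  have hedge : subCost σ (G.subgraphOfAdj (T.adj_sub hux)) = σ s(u, x) :=
    subCost_subgraphOfAdj σ _
  have hedge_le : G.subgraphOfAdj (T.adj_sub hux) ≤ T := subgraphOfAdj_le_of_adj T hux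
  have hnotMem : ∀ y, s(u, x) ∉ (componentSubgraph hD y).edgeSet :=
    fun y h => (hDadj.1 (Subgraph.mem_edgeSet.1 h).1).2 rfl
  have hsep : ¬ D.Reachable u x := by
    intro hr
    have h₁ := csmt_le_subCost σ (S := S) (componentSubgraph_connected hD u) fun a ha =>
      (hcover a (hS ha)).elim id fun h => hr.trans h
    have h₂ := subCost_add_le σ (hle u (T.edge_vert hux)) hedge_le
      (by simpa using hnotMem u)
    omega
  have hdisj : Disjoint (componentSubgraph hD u).edgeSet (componentSubgraph hD x).edgeSet := by
    rw [Set.disjoint_left]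
    intro e
    induction e using Sym2.ind with
    | _ a b =>
      intro h h'
      exact hsep ((Subgraph.mem_edgeSet.1 h).2.trans (Subgraph.mem_edgeSet.1 h').2.symm)
  refine ⟨componentSubgraph hD u, componentSubgraph hD x, componentSubgraph_connected hD u,
    componentSubgraph_connected hD x, Reachable.refl u, Reachable.refl x, hcover, ?_⟩
  have hux_le := sup_le (hle u (T.edge_vert hux)) (hle x (T.edge_vert hux.symm))
  have h₁ := subCost_add_le σ hux_le hedge_le (by
    rw [Subgraph.edgeSet_sup, edgeSet_subgraphOfAdj, Set.disjoint_singleton_right]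
    exact fun h => h.elim (hnotMem u) (hnotMem x))
  have h₂ := subCost_add_le σ (le_sup_left (a := componentSubgraph hD u))
    (le_sup_right (b := componentSubgraph hD x)) hdisj
  omega

lemma exists_adj_of_connected {G : SimpleGraph V} {T : G.Subgraph} (hT : T.Connected) {u y : V}
    (hu : u ∈ T.verts) (hy : y ∈ T.verts) (hne : y ≠ u) : ∃ x, T.Adj u x := by
  obtain ⟨w⟩ := hT.coe ⟨u, hu⟩ ⟨y, hy⟩
  cases w with
  | nil => exact absurd rfl hne
  | cons h _ => exact ⟨_, h⟩

/-- One step of the Dreyfus-Wagner recursion: combine at `u` or move along an edge. -/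
lemma lstar_combine_or_step [Fintype V] {G : SimpleGraph V} {σ : Sym2 V → ℕ}
    (hconn : G.Connected) (hpos : ∀ e ∈ G.edgeSet, 0 < σ e) (u : V) {I : Set V}
    (hI : 2 ≤ I.ncard) :
    (∃ J : Set V, ∅ ⊂ J ∧ J ⊂ I ∧ lstar G σ u I = lstar G σ u J + lstar G σ u (I \ J)) ∨
      ∃ x, G.Adj u x ∧ lstar G σ x I + σ s(u, x) ≤ lstar G σ u I := by
  obtain ⟨T, hT, hS, hc⟩ := exists_connected_subCost_eq_csmt σ hconn (I ∪ {u})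
  obtain ⟨y, hy, hyu⟩ := Set.exists_ne_of_one_lt_ncard (by omega : 1 < I.ncard) u
  obtain ⟨x, hux⟩ := exists_adj_of_connected hT (hS (by simp)) (hS (Or.inl hy)) hyu
  obtain ⟨A, B, hA, hB, huA, hxB, hcover, hcost⟩ := exists_split hpos hT hS hc hux
  have hG := T.adj_sub hux
  have hσ := hpos s(u, x) hG
  by_cases hIB : I ⊆ B.verts
  · right
    have h := csmt_le_subCost σ (S := I ∪ {x}) hB
      (Set.union_subset hIB (Set.singleton_subset_iff.2 hxB))
    refine ⟨x, hG, ?_⟩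
    unfold lstar
    omega
  left
  have hdiff : I \ (I ∩ B.verts) ⊆ A.verts := fun a ha =>
    (hcover (hS (Or.inl ha.1))).resolve_right fun h => ha.2 ⟨ha.1, h⟩
  have hAcost := csmt_le_subCost σ (S := (I \ (I ∩ B.verts)) ∪ {u}) hA
    (Set.union_subset hdiff (Set.singleton_subset_iff.2 huA))
  refine ⟨I ∩ B.verts, ?_, ?_, ?_⟩
  · rw [Set.empty_ssubset, Set.nonempty_iff_ne_empty]
    intro h
    rw [h, Set.sdiff_empty] at hAcost
    omega
  · exact ⟨Set.inter_subset_left, fun h => hIB fun a ha => (h ha).2⟩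
  · have hBu := Subgraph.connected_sup hB.preconnected
      (Subgraph.subgraphOfAdj_connected hG).preconnected ⟨x, hxB, by simp⟩
    have h₁ := csmt_le_subCost σ (S := (I ∩ B.verts) ∪ {u}) hBu
      (Set.union_subset_union Set.inter_subset_right (by simp))
    have h₂ := subCost_sup_le σ B (G.subgraphOfAdj hG)
    rw [subCost_subgraphOfAdj] at h₂
    have h₃ := lstar_le_add σ hconn u (Set.inter_subset_left : I ∩ B.verts ⊆ I)
    unfold lstar at h₃ ⊢
    omega

lemma exists_combine_vertex [Fintype V] {G : SimpleGraph V} {σ : Sym2 V → ℕ}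
    (hconn : G.Connected) (hpos : ∀ e ∈ G.edgeSet, 0 < σ e) {I : Set V} (hI : 2 ≤ I.ncard)
    (u : V) :
    ∃ v, lstar G σ u I = lstar G σ v I + netDist G σ u v ∧
      ∃ J : Set V, ∅ ⊂ J ∧ J ⊂ I ∧ lstar G σ v I = lstar G σ v J + lstar G σ v (I \ J) := by
  induction hn : lstar G σ u I using Nat.strong_induction_on generalizing u with
  | _ n ih =>
    subst hn
    rcases lstar_combine_or_step hconn hpos u hI with h | ⟨x, hux, hx⟩
    · exact ⟨u, by simp [netDist_self], h⟩
    · have hσ := hpos s(u, x) hux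
      obtain ⟨v, hv, hJ⟩ := ih _ (by omega) x rfl
      refine ⟨v, ?_, hJ⟩
      have h₁ := netDist_le_add σ hconn hux v
      have h₂ := lstar_le_add_netDist σ hconn u v I
      omega

end SteinerTree

/-- Every sub-SMT cost decomposes by combination at `u`, or by a
shortest path to a vertex `v ≠ u` at which a combination happens. -/
theorem dreyfus_wagner_case_split
    [Fintype V] (G : SimpleGraph V) (σ : Sym2 V → ℕ)
    (hconn : G.Connected) (hpos : ∀ e ∈ G.edgeSet, 0 < σ e)
    (R : Set V) (hR : R.Nonempty)
    (u : V) (I : Set V) (hIR : I ⊆ R) (hI : 2 ≤ I.ncard) :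
    (∃ J : Set V, ∅ ⊂ J ∧ J ⊂ I ∧
        lstar G σ u I = lstar G σ u J + lstar G σ u (I \ J)) ∨
    (∃ v : V, v ≠ u ∧ lstar G σ u I = lstar G σ v I + netDist G σ u v ∧
        ∃ J : Set V, ∅ ⊂ J ∧ J ⊂ I ∧
          lstar G σ v I = lstar G σ v J + lstar G σ v (I \ J)) := by
  obtain ⟨v, hv, hJ⟩ := SteinerTree.exists_combine_vertex hconn hpos hI u
  by_cases hvu : v = u
  · subst hvu
    exact Or.inl hJ
  · exact Or.inr ⟨v, hvu, hv, hJ⟩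
end

section
/- Let (N,R) be an STP instance with N=(V,E,σ), and let u∈V∖R be a non-terminal vertex of degree exactly 2, with incident edges {u,v} and {u,v'}. Let N' be the network obtained from N by deleting u (and its two incident edges) and adding the edge {v,v'} with cost σ({u,v})+σ({u,v'}); if the edge {v,v'} was already present in E, its cost in N' is the minimum of its old cost and σ({u,v})+σ({u,v'}). Then csmt(N,R) = csmt(N',R). -/
open SimpleGraph

variable {V : Type*}

/-- Reachability is transported along a vertex map that sends edges to connected pairs. -/
theorem reachable_map_of_edges {K K' : SimpleGraph V} (f : V → V)
    (hf : ∀ a b, K.Adj a b → K'.Reachable (f a) (f b)) {x y : V} (h : K.Reachable x y) :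
    K'.Reachable (f x) (f y) := by
  obtain ⟨p⟩ := h
  induction p with
  | nil => exact Reachable.refl _
  | cons hadj _ ih => exact (hf _ _ hadj).trans ih

/-- The edge set `S` connects any two vertices of `R`. -/
def Connects (S : Finset (Sym2 V)) (R : Set V) : Prop :=
  ∀ x ∈ R, ∀ y ∈ R, (fromEdgeSet (S : Set (Sym2 V))).Reachable x y

/-- The edges of a Steiner tree connect the terminals. -/
theorem IsSteinerTree.connects [Fintype V] {G : SimpleGraph V} {R : Set V} {H : G.Subgraph}
    (h : IsSteinerTree R H) : Connects H.edgeSet.toFinite.toFinset R := by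
  intro x hx y hy
  refine (h.1.connected ⟨x, h.2 hx⟩ ⟨y, h.2 hy⟩).map (G' := fromEdgeSet _) ⟨Subtype.val, ?_⟩
  intro a b hab
  have hab' : H.Adj a b := hab
  simp [hab', hab'.ne]

/-- A connecting edge set contains the edges of a Steiner tree. -/
theorem Connects.exists_isSteinerTree [Fintype V] {G : SimpleGraph V} {R : Set V}
    (hR : R.Nonempty) {S : Finset (Sym2 V)} (hS : (S : Set (Sym2 V)) ⊆ G.edgeSet)
    (h : Connects S R) (σ : Sym2 V → ℕ) :
    ∃ H : G.Subgraph, IsSteinerTree R H ∧ subCost σ H ≤ ∑ e ∈ S, σ e := by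
  obtain ⟨r, hr⟩ := hR
  let C := (fromEdgeSet (S : Set (Sym2 V))).connectedComponentMk r
  obtain ⟨T, hTle, hT⟩ := C.connected_toSimpleGraph.exists_isTree_le
  have hTS : ∀ a b, T.Adj a b → s((a : V), (b : V)) ∈ S := by
    intro a b hab
    have hadj : (fromEdgeSet (S : Set (Sym2 V))).Adj a b := hTle hab
    simpa using ((fromEdgeSet_adj _).1 hadj).1
  let H : G.Subgraph :=
    { verts := C.supp
      Adj := fun a b => ∃ (ha : a ∈ C.supp) (hb : b ∈ C.supp), T.Adj ⟨a, ha⟩ ⟨b, hb⟩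
      adj_sub := fun ⟨_, _, hab⟩ => hS (hTS _ _ hab)
      edge_vert := fun ⟨ha, _, _⟩ => ha
      symm := ⟨fun _ _ ⟨ha, hb, hab⟩ => ⟨hb, ha, hab.symm⟩⟩ }
  have hH : H.coe = T := by
    ext a b
    exact ⟨fun ⟨_, _, hab⟩ => hab, fun hab => ⟨a.2, b.2, hab⟩⟩
  refine ⟨H, ⟨hH ▸ hT, fun x hx => ConnectedComponent.sound (h x hx r hr)⟩, ?_⟩
  refine Finset.sum_le_sum_of_subset fun e he => ?_
  induction e with
  | _ a b =>
    obtain ⟨_, _, hab⟩ : H.Adj a b := by simpa using he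
    exact hTS _ _ hab

/-- If connecting edge sets of one network can be turned into connecting edge sets of the other
at no extra cost, then the same holds for Steiner trees. -/
theorem exists_isSteinerTree_le [Fintype V] {G G' : SimpleGraph V} {σ σ' : Sym2 V → ℕ}
    {R : Set V} (hR : R.Nonempty)
    (h : ∀ S : Finset (Sym2 V), (S : Set (Sym2 V)) ⊆ G.edgeSet → Connects S R →
      ∃ S' : Finset (Sym2 V), (S' : Set (Sym2 V)) ⊆ G'.edgeSet ∧ Connects S' R ∧
        ∑ e ∈ S', σ' e ≤ ∑ e ∈ S, σ e) (H : G.Subgraph) (hH : IsSteinerTree R H) :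
    ∃ H' : G'.Subgraph, IsSteinerTree R H' ∧ subCost σ' H' ≤ subCost σ H := by
  obtain ⟨S', hS', hc, hle⟩ := h _ (by simpa using H.edgeSet_subset) hH.connects
  obtain ⟨H', hH', hle'⟩ := hc.exists_isSteinerTree hR hS' σ'
  exact ⟨H', hH', hle'.trans hle⟩

theorem csmt_eq_of_forall_exists_le [Fintype V] {G G' : SimpleGraph V} {σ σ' : Sym2 V → ℕ}
    {R : Set V}
    (h : ∀ H : G.Subgraph, IsSteinerTree R H →
      ∃ H' : G'.Subgraph, IsSteinerTree R H' ∧ subCost σ' H' ≤ subCost σ H)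
    (h' : ∀ H' : G'.Subgraph, IsSteinerTree R H' →
      ∃ H : G.Subgraph, IsSteinerTree R H ∧ subCost σ H ≤ subCost σ' H') :
    csmt G σ R = csmt G' σ' R := by
  by_cases hne : ∃ H : G.Subgraph, IsSteinerTree R H
  · obtain ⟨H, hH⟩ := hne
    obtain ⟨H', hH', -⟩ := h H hH
    apply le_antisymm
    · obtain ⟨K', hK', hc⟩ := Nat.sInf_mem
        (s := {c | ∃ H : G'.Subgraph, IsSteinerTree R H ∧ subCost σ' H = c}) ⟨_, H', hH', rfl⟩
      obtain ⟨K, hK, hle⟩ := h' K' hK'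
      exact le_trans (Nat.sInf_le ⟨K, hK, rfl⟩) (hle.trans hc.le)
    · obtain ⟨K, hK, hc⟩ := Nat.sInf_mem
        (s := {c | ∃ H : G.Subgraph, IsSteinerTree R H ∧ subCost σ H = c}) ⟨_, H, hH, rfl⟩
      obtain ⟨K', hK', hle⟩ := h K hK
      exact le_trans (Nat.sInf_le ⟨K', hK', rfl⟩) (hle.trans hc.le)
  · have hne' : ¬ ∃ H' : G'.Subgraph, IsSteinerTree R H' := fun ⟨H', hH'⟩ =>
      hne ((h' H' hH').imp fun _ => And.left)
    push Not at hne hne'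
    simp [csmt, hne, hne']

/-- An edge set remains connecting when each of its edges is mapped to a connected pair by a
vertex map fixing the terminals. -/
theorem Connects.map {S S' : Finset (Sym2 V)} {R : Set V} (h : Connects S R) (f : V → V)
    (hfR : ∀ x ∈ R, f x = x)
    (hf : ∀ a b, s(a, b) ∈ S → (fromEdgeSet (S' : Set (Sym2 V))).Reachable (f a) (f b)) :
    Connects S' R := by
  intro x hx y hy
  rw [← hfR x hx, ← hfR y hy]
  exact reachable_map_of_edges f (fun a b hab => hf a b (by simpa using hab.1)) (h x hx y hy)

theorem reachable_of_mem {S : Finset (Sym2 V)} {a b : V} (h : s(a, b) ∈ S) :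
    (fromEdgeSet (S : Set (Sym2 V))).Reachable a b := by
  by_cases hab : a = b
  · exact hab ▸ Reachable.refl _
  · exact Adj.reachable (by simp [h, hab])

/-- Contracting a non-terminal of degree 2 (replacing it by a direct
edge between its two neighbors, keeping the cheaper edge if one already exists)
preserves the Steiner minimal tree cost. -/
theorem contract_degree_two_nonterminal
    [Fintype V] (G : SimpleGraph V) (σ : Sym2 V → ℕ)
    (hconn : G.Connected) (hpos : ∀ e ∈ G.edgeSet, 0 < σ e)
    (R : Set V) (hR : R.Nonempty)
    (u v w : V) (hu : u ∉ R) (hvw : v ≠ w)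
    (hnbr : G.neighborSet u = {v, w})
    (G' : SimpleGraph V) (σ' : Sym2 V → ℕ)
    (hG' : G'.edgeSet = (G.edgeSet \ {s(u, v), s(u, w)}) ∪ {s(v, w)})
    (hσnew : s(v, w) ∉ G.edgeSet → σ' s(v, w) = σ s(u, v) + σ s(u, w))
    (hσold : s(v, w) ∈ G.edgeSet →
      σ' s(v, w) = min (σ s(v, w)) (σ s(u, v) + σ s(u, w)))
    (hσrest : ∀ e : Sym2 V, e ≠ s(v, w) → σ' e = σ e) :
    csmt G σ R = csmt G' σ' R := by
  classical
  have huv : G.Adj u v := by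
    have : v ∈ G.neighborSet u := by simp [hnbr]
    exact this
  have huw : G.Adj u w := by
    have : w ∈ G.neighborSet u := by simp [hnbr]
    exact this
  have hadj : ∀ x, s(u, x) ∈ G.edgeSet → x = v ∨ x = w := by
    intro x hx
    have : x ∈ G.neighborSet u := hx
    simpa [hnbr] using this
  have huv' := huv.ne
  have huw' := huw.ne
  have hne : s(u, v) ≠ s(u, w) := by simp [hvw, huw']
  have hne₁ : s(v, w) ≠ s(u, v) := by simp [huv'.symm, huw'.symm]
  have hne₂ : s(v, w) ≠ s(u, w) := by simp [huv'.symm, huw'.symm]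
  have hσle : σ' s(v, w) ≤ σ s(u, v) + σ s(u, w) := by
    by_cases h : s(v, w) ∈ G.edgeSet
    · exact (hσold h).trans_le (min_le_right _ _)
    · exact (hσnew h).le
  have hσ'σ : ∀ e ∈ G.edgeSet, σ' e ≤ σ e := by
    intro e he
    by_cases h : e = s(v, w)
    · subst h
      exact (hσold he).trans_le (min_le_left _ _)
    · exact (hσrest e h).le
  refine csmt_eq_of_forall_exists_le (exists_isSteinerTree_le hR ?_) (exists_isSteinerTree_le hR ?_)
  · intro S hSG hS
    by_cases hboth : s(u, v) ∈ S ∧ s(u, w) ∈ S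
    · obtain ⟨hv, hw⟩ := hboth
      refine ⟨insert s(v, w) ((S.erase s(u, v)).erase s(u, w)), ?_, ?_, ?_⟩
      · intro e he
        have hSe := @hSG e
        rw [hG']
        simp only [Finset.coe_insert, Finset.coe_erase, Set.mem_insert_iff, Set.mem_sdiff,
          Set.mem_singleton_iff, Set.mem_union] at he hSe ⊢
        tauto
      · refine hS.map (fun x => if x = u then v else x) (by rintro x hx; grind) ?_
        have hvwr : (fromEdgeSet ((insert s(v, w) ((S.erase s(u, v)).erase s(u, w)) :
            Finset (Sym2 V)) : Set (Sym2 V))).Reachable v w :=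
          reachable_of_mem (by simp)
        intro a b hab
        by_cases ha : a = u
        · subst ha
          rcases hadj b (hSG hab) with rfl | rfl
          · simp [huv'.symm]
          · simpa [huw'.symm] using hvwr
        · by_cases hb : b = u
          · subst hb
            rcases hadj a (hSG (Sym2.eq_swap ▸ hab)) with rfl | rfl
            · simp [huv'.symm]
            · simpa [huw'.symm] using hvwr.symm
          · simp only [ha, hb, if_false]
            apply reachable_of_mem
            simp [ha, hb, hab]
      · have h₁ := Finset.add_sum_erase S σ hv
        have h₂ := Finset.add_sum_erase (S.erase s(u, v)) σ
          (Finset.mem_erase.2 ⟨hne.symm, hw⟩)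
        have h₃ : ∑ e ∈ ((S.erase s(u, v)).erase s(u, w)).erase s(v, w), σ' e ≤
            ∑ e ∈ (S.erase s(u, v)).erase s(u, w), σ e := by
          refine le_trans (Finset.sum_le_sum fun e he => ?_)
            (Finset.sum_le_sum_of_subset (Finset.erase_subset _ _))
          exact (hσrest e (Finset.ne_of_mem_erase he)).le
        have h₄ := Finset.add_sum_erase _ σ'
          (Finset.mem_insert_self s(v, w) ((S.erase s(u, v)).erase s(u, w)))
        rw [Finset.erase_insert_eq_erase] at h₄
        omega
    · refine ⟨(S.erase s(u, v)).erase s(u, w), ?_, ?_, ?_⟩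
      · intro e he
        have hSe := @hSG e
        rw [hG']
        simp only [Finset.coe_erase, Set.mem_insert_iff, Set.mem_sdiff,
          Set.mem_singleton_iff, Set.mem_union] at he hSe ⊢
        tauto
      · refine hS.map (fun x => if x = u then (if s(u, v) ∈ S then v else w) else x)
          (by rintro x hx; grind) ?_
        have key : ∀ x, s(u, x) ∈ S → (if s(u, v) ∈ S then v else w) = x := by
          intro x hx
          rcases hadj x (hSG hx) with rfl | rfl
          · simp [hx]
          · grind
        intro a b hab
        by_cases ha : a = u
        · subst ha
          have hb : b ≠ a := (G.ne_of_adj (hSG hab)).symm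
          simp only [if_true, hb, if_false, key b hab, Reachable.refl]
        · by_cases hb : b = u
          · subst hb
            simp only [if_true, ha, if_false, key a (Sym2.eq_swap ▸ hab), Reachable.refl]
          · simp only [ha, hb, if_false]
            apply reachable_of_mem
            simp [ha, hb, hab]
      · refine le_trans (Finset.sum_le_sum fun e he => hσ'σ e (hSG ?_))
          (Finset.sum_le_sum_of_subset ?_)
        · exact Finset.mem_of_mem_erase (Finset.mem_of_mem_erase he)
        · exact (Finset.erase_subset _ _).trans (Finset.erase_subset _ _)
  · intro S hSG hS
    have hSG' : ∀ e ∈ S, e ≠ s(v, w) → e ∈ G.edgeSet := by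
      intro e he hne
      have := hSG he
      rw [hG'] at this
      exact (this.resolve_right hne).1
    by_cases hkeep : s(v, w) ∈ S → s(v, w) ∈ G.edgeSet ∧ σ s(v, w) ≤ σ' s(v, w)
    · refine ⟨S, fun e he => ?_, hS, Finset.sum_le_sum fun e he => ?_⟩
      · by_cases h : e = s(v, w)
        · subst h
          exact (hkeep he).1
        · exact hSG' e he h
      · by_cases h : e = s(v, w)
        · subst h
          exact (hkeep he).2
        · exact (hσrest e h).ge
    · push Not at hkeep
      obtain ⟨hmem, hlt⟩ := hkeep
      have hσeq : σ' s(v, w) = σ s(u, v) + σ s(u, w) := by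
        by_cases h : s(v, w) ∈ G.edgeSet
        · have := hlt h
          have := hσold h
          omega
        · exact hσnew h
      refine ⟨insert s(u, v) (insert s(u, w) (S.erase s(v, w))), ?_, ?_, ?_⟩
      · intro e he
        simp only [Finset.coe_insert, Finset.coe_erase, Set.mem_insert_iff, Set.mem_sdiff,
          Set.mem_singleton_iff, Finset.mem_coe] at he
        rcases he with rfl | rfl | ⟨he, hne⟩
        · exact huv
        · exact huw
        · exact hSG' e he hne
      · refine hS.map id (fun _ _ => rfl) fun a b hab => ?_
        by_cases h : s(a, b) = s(v, w)
        · have hvwr : (fromEdgeSet ((insert s(u, v) (insert s(u, w) (S.erase s(v, w))) :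
              Finset (Sym2 V)) : Set (Sym2 V))).Reachable v w :=
            (reachable_of_mem (a := u) (by simp)).symm.trans (reachable_of_mem (by simp))
          rcases Sym2.eq_iff.1 h with ⟨rfl, rfl⟩ | ⟨rfl, rfl⟩
          · exact hvwr
          · exact hvwr.symm
        · apply reachable_of_mem
          simp only [id, Finset.mem_insert, Finset.mem_erase]
          exact Or.inr (Or.inr ⟨h, hab⟩)
      · have h₁ := Finset.add_sum_erase S σ' hmem
        have h₂ : ∑ e ∈ S.erase s(v, w), σ e = ∑ e ∈ S.erase s(v, w), σ' e :=
          Finset.sum_congr rfl fun e he => (hσrest e (Finset.ne_of_mem_erase he)).symm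
        have h₃ : ∀ (T : Finset (Sym2 V)) (e : Sym2 V),
            ∑ x ∈ insert e T, σ x ≤ σ e + ∑ x ∈ T, σ x := by
          intro T e
          by_cases he : e ∈ T
          · simp [he]
          · rw [Finset.sum_insert he]
        have h₄ := h₃ (insert s(u, w) (S.erase s(v, w))) s(u, v)
        have h₅ := h₃ (S.erase s(v, w)) s(u, w)
        omega
end

section
/- Let (N,R) be an STP instance with N=(V,E,σ), and let base: V→R be a Voronoi assignment, i.e., d_N(x,base(x)) ≤ d_N(x,z') for every x∈V and every z'∈R. Fix a terminal z∈R, and call an edge {x,y}∈E a link of z if base(x)=z and base(y)≠z. Let {u,v} be a minimum-cost link of z (with base(u)=z) and let {u',v'} be a minimum-cost link of z among the links of z other than {u,v} (with base(u')=z). If σ({u',v'}) ≥ d_N(z,u) + σ({u,v}) + d_N(v,base(v)), then the edge {u,v} belongs to at least one SMT of (N,R). -/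
open SimpleGraph

variable {V : Type*}

namespace SimpleGraph

variable {G : SimpleGraph V}

lemma exists_walk_walkCost_eq_netDist (hG : G.Connected) (σ : Sym2 V → ℕ) (a b : V) :
    ∃ w : G.Walk a b, walkCost σ w = netDist G σ a b :=
  Nat.sInf_mem (s := {c | ∃ w : G.Walk a b, walkCost σ w = c})
    ((hG.preconnected a b).elim fun w => ⟨_, w, rfl⟩)

lemma netDist_self (σ : Sym2 V → ℕ) (a : V) : netDist G σ a a = 0 :=
  Nat.sInf_eq_zero.2 (Or.inl ⟨Walk.nil, by simp [walkCost]⟩)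

lemma eq_of_netDist_eq_zero (hG : G.Connected) {σ : Sym2 V → ℕ}
    (hpos : ∀ e ∈ G.edgeSet, 0 < σ e) {a b : V} (h : netDist G σ a b = 0) : a = b := by
  obtain ⟨w, hw⟩ := exists_walk_walkCost_eq_netDist hG σ a b
  cases w with
  | nil => rfl
  | cons hadj w =>
    have := hpos _ ((mem_edgeSet G).2 hadj)
    simp only [walkCost, Walk.edges_cons, List.map_cons, List.sum_cons] at hw
    omega

section Cost

variable [Fintype V] {σ : Sym2 V → ℕ}

lemma csmt_le_subCost {R : Set V} {H : G.Subgraph} (hH : IsSteinerTree R H) :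
    csmt G σ R ≤ subCost σ H :=
  Nat.sInf_le ⟨H, hH, rfl⟩

lemma subCost_sup_le (H K : G.Subgraph) : subCost σ (H ⊔ K) ≤ subCost σ H + subCost σ K := by
  classical
  simp only [subCost]
  rw [← Finset.sum_union_inter]
  refine le_trans (Finset.sum_le_sum_of_subset ?_) (Nat.le_add_right _ _)
  intro e
  simp

lemma subCost_toSubgraph_le {a b : V} (w : G.Walk a b) :
    subCost σ w.toSubgraph ≤ walkCost σ w := by
  classical
  have : w.toSubgraph.edgeSet.toFinite.toFinset = w.edges.toFinset := by
    ext e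
    simp
  rw [subCost, this, walkCost, Finset.sum_list_map_count]
  refine Finset.sum_le_sum fun e he => ?_
  rw [smul_eq_mul]
  exact Nat.le_mul_of_pos_left _ (List.count_pos_iff.2 (List.mem_toFinset.1 he))

lemma subCost_deleteEdges_add {H : G.Subgraph} {e : Sym2 V} (he : e ∈ H.edgeSet) :
    subCost σ (H.deleteEdges {e}) + σ e = subCost σ H := by
  classical
  have : (H.deleteEdges {e}).edgeSet.toFinite.toFinset
      = H.edgeSet.toFinite.toFinset.erase e := by
    ext e'
    induction e' with
    | h x y => simp [and_comm]
  rw [subCost, this]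
  exact Finset.sum_erase_add _ _ (by simpa using he)

/-- A connected subgraph contains a spanning tree; if the costs are positive, either the
subgraph is itself a tree or the spanning tree is strictly cheaper. -/
lemma Subgraph.Connected.isTree_or_exists_lt (hpos : ∀ e ∈ G.edgeSet, 0 < σ e)
    {H : G.Subgraph} (hH : H.Connected) :
    H.coe.IsTree ∨ ∃ K : G.Subgraph, K.verts = H.verts ∧ K.coe.IsTree ∧
      subCost σ K < subCost σ H := by
  obtain ⟨T, hTle, hT⟩ := hH.coe.exists_isTree_le
  by_cases heq : T = H.coe
  · exact Or.inl (heq ▸ hT)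
  right
  let K : G.Subgraph :=
    { verts := H.verts
      Adj := fun a b => ∃ (ha : a ∈ H.verts) (hb : b ∈ H.verts), T.Adj ⟨a, ha⟩ ⟨b, hb⟩
      adj_sub := fun ⟨_, _, h⟩ => H.adj_sub (hTle h)
      edge_vert := fun ⟨ha, _, _⟩ => ha
      symm := ⟨fun _ _ ⟨ha, hb, h⟩ => ⟨hb, ha, h.symm⟩⟩ }
  have hK : K.coe = T := by
    ext a b
    exact ⟨fun ⟨_, _, h⟩ => h, fun h => ⟨a.2, b.2, h⟩⟩
  refine ⟨K, rfl, hK ▸ hT, ?_⟩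
  have hlt : ∃ a b, H.coe.Adj a b ∧ ¬ T.Adj a b := by
    by_contra! hcon
    exact heq (le_antisymm hTle fun a b h => hcon a b h)
  obtain ⟨a, b, hab, hnab⟩ := hlt
  refine Finset.sum_lt_sum_of_subset (i := s(a.1, b.1)) ?_ ?_ ?_
    (hpos _ (H.edgeSet_subset (Subgraph.mem_edgeSet.2 hab))) (fun _ _ _ => Nat.zero_le _)
  · intro e
    induction e with
    | h x y =>
      simp only [Set.Finite.mem_toFinset, Subgraph.mem_edgeSet]
      exact fun ⟨_, _, h⟩ => hTle h
  · simpa using hab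
  · simp only [Set.Finite.mem_toFinset, Subgraph.mem_edgeSet]
    exact fun ⟨_, _, h⟩ => hnab h

lemma Subgraph.Connected.isSMT_of_subCost_le (hpos : ∀ e ∈ G.edgeSet, 0 < σ e) {R : Set V}
    {H : G.Subgraph} (hH : H.Connected) (hR : R ⊆ H.verts)
    (hcost : subCost σ H ≤ csmt G σ R) : IsSMT G σ R H := by
  obtain hT | ⟨K, hKv, hKT, hlt⟩ := hH.isTree_or_exists_lt hpos
  · exact ⟨⟨hT, hR⟩, le_antisymm hcost (csmt_le_subCost ⟨hT, hR⟩)⟩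
  · have := csmt_le_subCost (σ := σ) (R := R) ⟨hKT, hKv ▸ hR⟩
    omega

lemma exists_isSMT (hG : G.Connected) (hpos : ∀ e ∈ G.edgeSet, 0 < σ e) (R : Set V) :
    ∃ H : G.Subgraph, IsSMT G σ R H := by
  have hne : {c | ∃ H : G.Subgraph, IsSteinerTree R H ∧ subCost σ H = c}.Nonempty := by
    obtain hT | ⟨K, hKv, hKT, -⟩ := (Subgraph.connected_iff'.2
      ((Subgraph.topIso (G := G)).connected_iff.2 hG)).isTree_or_exists_lt hpos
    · exact ⟨_, ⊤, ⟨hT, by simp⟩, rfl⟩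
    · exact ⟨_, K, ⟨hKT, by simp [hKv]⟩, rfl⟩
  exact Nat.sInf_mem hne

end Cost

lemma Walk.exists_append_cons_of_boundary {a b : V} (p : G.Walk a b) (S : V → Prop)
    (ha : S a) (hb : ¬ S b) :
    ∃ (x y : V) (h : G.Adj x y) (p₁ : G.Walk a x) (p₂ : G.Walk y b),
      S x ∧ ¬ S y ∧ p = p₁.append (Walk.cons h p₂) := by
  induction p with
  | nil => exact absurd ha hb
  | @cons a c b hadj p ih =>
    by_cases hc : S c
    · obtain ⟨x, y, h, p₁, p₂, hx, hy, rfl⟩ := ih hc hb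
      exact ⟨x, y, h, Walk.cons hadj p₁, p₂, hx, hy, rfl⟩
    · exact ⟨a, c, hadj, Walk.nil, p, ha, hc, rfl⟩

lemma Walk.toSubgraph_le_deleteEdges {H : G.Subgraph} {a b : V} {p : G.Walk a b}
    {e : Sym2 V} (hp : p.toSubgraph ≤ H) (he : e ∉ p.edges) :
    p.toSubgraph ≤ H.deleteEdges {e} := by
  refine ⟨hp.1, fun x y hxy => ?_⟩
  rw [Subgraph.deleteEdges_adj]
  refine ⟨hp.2 hxy, fun h => he ?_⟩
  rw [← Set.mem_singleton_iff.1 h]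
  exact (Walk.mem_edges_toSubgraph p).1 hxy

/-- A walk in `H` to `x` yields a walk to `x` or to `y` that avoids the edge `s(x, y)`. -/
lemma Walk.exists_walk_deleteEdges {H : G.Subgraph} {a x : V} (y : V) (p : G.Walk a x)
    (hp : p.toSubgraph ≤ H) :
    (∃ q : G.Walk a x, q.toSubgraph ≤ H.deleteEdges {s(x, y)}) ∨
      ∃ q : G.Walk a y, q.toSubgraph ≤ H.deleteEdges {s(x, y)} := by
  induction p with
  | nil => exact Or.inl ⟨Walk.nil, Walk.toSubgraph_le_deleteEdges hp (by simp)⟩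
  | @cons a c x h p ih =>
    rw [Walk.toSubgraph, sup_le_iff] at hp
    have ha : a ∈ H.verts := hp.1.1 (by simp)
    have hnil : ∀ e, (Walk.nil : G.Walk a a).toSubgraph ≤ H.deleteEdges {e} := fun e => by
      simpa using ha
    by_cases he : s(a, c) = s(x, y)
    · rcases Sym2.eq_iff.1 he with ⟨rfl, -⟩ | ⟨rfl, -⟩
      · exact Or.inl ⟨Walk.nil, hnil _⟩
      · exact Or.inr ⟨Walk.nil, hnil _⟩
    · have hac : G.subgraphOfAdj h ≤ H.deleteEdges {s(x, y)} := by
        refine ⟨hp.1.1, fun s t hst => ?_⟩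
        rw [Subgraph.deleteEdges_adj]
        refine ⟨hp.1.2 hst, fun h' => he ?_⟩
        rw [← Set.mem_singleton_iff.1 h']
        exact hst
      rcases ih hp.2 with ⟨q, hq⟩ | ⟨q, hq⟩
      · exact Or.inl ⟨Walk.cons h q, sup_le hac hq⟩
      · exact Or.inr ⟨Walk.cons h q, sup_le hac hq⟩

/-- Exchanging an edge of a trail in a connected subgraph for a walk between the endpoints of
the trail preserves connectedness. -/
lemma Subgraph.Connected.deleteEdges_sup_toSubgraph {H : G.Subgraph} (hH : H.Connected)
    {a b x y : V} {h : G.Adj x y} {p₁ : G.Walk a x} {p₂ : G.Walk y b}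
    (hp : (p₁.append (Walk.cons h p₂)).IsTrail)
    (hpH : (p₁.append (Walk.cons h p₂)).toSubgraph ≤ H) (w : G.Walk a b) :
    (H.deleteEdges {s(x, y)} ⊔ w.toSubgraph).Connected := by
  classical
  set K := H.deleteEdges {s(x, y)} ⊔ w.toSubgraph with hK
  have hnodup := hp.edges_nodup
  rw [Walk.edges_append, Walk.edges_cons, List.nodup_append] at hnodup
  rw [Walk.toSubgraph_append, Walk.toSubgraph, sup_le_iff, sup_le_iff] at hpH
  have h₁ : p₁.toSubgraph ≤ K := (Walk.toSubgraph_le_deleteEdges hpH.1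
    fun he => hnodup.2.2 _ he _ List.mem_cons_self rfl).trans le_sup_left
  have h₂ : p₂.toSubgraph ≤ K := (Walk.toSubgraph_le_deleteEdges hpH.2.2
    (List.nodup_cons.1 hnodup.2.1).1).trans le_sup_left
  have hw : w.toSubgraph ≤ K := le_sup_right
  have key : ∀ c ∈ K.verts, ∃ q : G.Walk c a, q.toSubgraph ≤ K := by
    rintro c (hc | hc)
    · obtain ⟨p, hpc⟩ := ((Subgraph.connected_iff_forall_exists_walk_subgraph _).1 hH).2
        hc (hpH.2.1.1 (by simp : x ∈ _))
      rcases p.exists_walk_deleteEdges y hpc with ⟨q, hq⟩ | ⟨q, hq⟩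
      · refine ⟨q.append p₁.reverse, ?_⟩
        rw [Walk.toSubgraph_append, Walk.toSubgraph_reverse]
        exact sup_le (hq.trans le_sup_left) h₁
      · refine ⟨(q.append p₂).append w.reverse, ?_⟩
        rw [Walk.toSubgraph_append, Walk.toSubgraph_append, Walk.toSubgraph_reverse]
        exact sup_le (sup_le (hq.trans le_sup_left) h₂) hw
    · obtain ⟨q, hq⟩ := ((Subgraph.connected_iff_forall_exists_walk_subgraph _).1
        w.toSubgraph_connected).2 hc w.start_mem_verts_toSubgraph
      exact ⟨q, hq.trans hw⟩
  refine (Subgraph.connected_iff_forall_exists_walk_subgraph _).2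
    ⟨⟨a, Or.inr w.start_mem_verts_toSubgraph⟩, fun {c d} hc hd => ?_⟩
  obtain ⟨q, hq⟩ := key c hc
  obtain ⟨r, hr⟩ := key d hd
  refine ⟨q.append r.reverse, ?_⟩
  rw [Walk.toSubgraph_append, Walk.toSubgraph_reverse]
  exact sup_le hq hr

end SimpleGraph

/-- Short-links test based on a Voronoi assignment of the vertices
to nearest terminals. -/
theorem short_links_in_some_smt
    [Fintype V] (G : SimpleGraph V) (σ : Sym2 V → ℕ)
    (hconn : G.Connected) (hpos : ∀ e ∈ G.edgeSet, 0 < σ e)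
    (R : Set V) (hRne : R.Nonempty)
    (base : V → V)
    (hbaseR : ∀ x : V, base x ∈ R)
    (hbase : ∀ x : V, ∀ z' ∈ R, netDist G σ x (base x) ≤ netDist G σ x z')
    (z : V) (hz : z ∈ R)
    (u v u' v' : V)
    (huv : G.Adj u v) (hbu : base u = z) (hbv : base v ≠ z)
    (hmin1 : ∀ x y : V, G.Adj x y → base x = z → base y ≠ z →
      σ s(u, v) ≤ σ s(x, y))
    (hu'v' : G.Adj u' v') (hbu' : base u' = z) (hbv' : base v' ≠ z)
    (hne : s(u', v') ≠ s(u, v))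
    (hmin2 : ∀ x y : V, G.Adj x y → base x = z → base y ≠ z →
      s(x, y) ≠ s(u, v) → σ s(u', v') ≤ σ s(x, y))
    (hcond : netDist G σ z u + σ s(u, v) + netDist G σ v (base v) ≤ σ s(u', v')) :
    ∃ H : G.Subgraph, IsSMT G σ R H ∧ s(u, v) ∈ H.edgeSet := by
  classical
  have hbase_self : ∀ r ∈ R, base r = r := fun r hr =>
    (eq_of_netDist_eq_zero hconn hpos
      (Nat.le_zero.1 ((hbase r r hr).trans_eq (netDist_self σ r)))).symm
  obtain ⟨T, hT⟩ := exists_isSMT hconn hpos R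
  by_cases huvT : s(u, v) ∈ T.edgeSet
  · exact ⟨T, hT, huvT⟩
  have hTconn : T.Connected := Subgraph.connected_iff'.2 hT.1.1.connected
  obtain ⟨p, hpT⟩ := ((Subgraph.connected_iff_forall_exists_walk_subgraph _).1 hTconn).2
    (hT.1.2 hz) (hT.1.2 (hbaseR v))
  have hqT : p.bypass.toSubgraph ≤ T := p.toSubgraph_bypass_le_toSubgraph.trans hpT
  have hq : p.bypass.IsTrail := p.bypass_isPath.isTrail
  obtain ⟨x, y, hxy, p₁, p₂, hx, hy, hsplit⟩ := p.bypass.exists_append_cons_of_boundary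
    (fun c => base c = z) (hbase_self z hz) (by rwa [hbase_self _ (hbaseR v)])
  rw [hsplit] at hqT hq
  have hxyT : s(x, y) ∈ T.edgeSet :=
    Subgraph.edgeSet_mono hqT ((Walk.mem_edges_toSubgraph _).2 (by simp))
  have hle := hmin2 x y hxy hx hy fun h => huvT (h ▸ hxyT)
  obtain ⟨w₁, hw₁⟩ := exists_walk_walkCost_eq_netDist hconn σ z u
  obtain ⟨w₂, hw₂⟩ := exists_walk_walkCost_eq_netDist hconn σ v (base v)
  let w : G.Walk z (base v) := w₁.append (Walk.cons huv w₂)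
  have hw : walkCost σ w = netDist G σ z u + σ s(u, v) + netDist G σ v (base v) := by
    rw [← hw₁, ← hw₂]
    simp [w, walkCost, add_assoc]
  refine ⟨T.deleteEdges {s(x, y)} ⊔ w.toSubgraph,
    (hTconn.deleteEdges_sup_toSubgraph hq hqT w).isSMT_of_subCost_le hpos
      (fun r hr => Or.inl (hT.1.2 hr)) ?_, ?_⟩
  · have h₁ := subCost_sup_le (σ := σ) (T.deleteEdges {s(x, y)}) w.toSubgraph
    have h₂ := subCost_toSubgraph_le (σ := σ) w
    have h₃ := subCost_deleteEdges_add (σ := σ) hxyT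
    have h₄ := hT.2
    omega
  · have huvw : s(u, v) ∈ w.toSubgraph.edgeSet :=
      (Walk.mem_edges_toSubgraph w).2 (by simp [w])
    exact Or.inr huvw
end
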